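/- Let N ≥ 1 and let W, Z_1, …, Z_{N+1} be random variables with finite ranges on a common finite probability space with I(W ; (Z_1, …, Z_{N+1})) = 0. For each i ∈ {1, …, N} let Q_i = {1, …, N+1} \ {i} and let X_{Q_i} be a random variable with finite range satisfying: (correctness) H(W | (X_{Q_i}, Z_q)) = 0 for every q ∈ Q_i; (security) I(W ; (X_{Q_i}, Z_i)) = 0; and (minimum broadcast bandwidth) H(X_{Q_i}) ≤ H(W). Then H(Z_{N+1}) ≥ N · H(W). -/

import Mathlib

open scoped BigOperators

/-- A finite probability space: a finite sample space `Ω` together with a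
probability mass function `p`. -/
structure FinProbSpace : Type 1 where
  Ω : Type
  fin : Fintype Ω
  p : Ω → ℝ
  nonneg : ∀ ω, 0 ≤ p ω
  sum_one : Finset.sum fin.elems p = 1

namespace FinProbSpace

/-- Probability that the random variable `X` takes the value `s`. -/
noncomputable def prob (μ : FinProbSpace) {S : Type} [DecidableEq S]
    (X : μ.Ω → S) (s : S) : ℝ :=
  letI := μ.fin
  ∑ ω : μ.Ω, if X ω = s then μ.p ω else 0

/-- Shannon entropy of a random variable with finite range. -/
noncomputable def H (μ : FinProbSpace) {S : Type} [Fintype S] [DecidableEq S]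
    (X : μ.Ω → S) : ℝ :=
  ∑ s : S, Real.negMulLog (μ.prob X s)

/-- Conditional Shannon entropy `H(X | Y)`. -/
noncomputable def Hc (μ : FinProbSpace) {S T : Type} [Fintype S] [DecidableEq S]
    [Fintype T] [DecidableEq T] (X : μ.Ω → S) (Y : μ.Ω → T) : ℝ :=
  μ.H (fun ω => (X ω, Y ω)) - μ.H Y

/-- Mutual information `I(X ; Y)`. -/
noncomputable def MI (μ : FinProbSpace) {S T : Type} [Fintype S] [DecidableEq S]
    [Fintype T] [DecidableEq T] (X : μ.Ω → S) (Y : μ.Ω → T) : ℝ :=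
  μ.H X + μ.H Y - μ.H (fun ω => (X ω, Y ω))

/-- Conditional mutual information `I(X ; Y | Z)`. -/
noncomputable def CMI (μ : FinProbSpace) {S T U : Type} [Fintype S] [DecidableEq S]
    [Fintype T] [DecidableEq T] [Fintype U] [DecidableEq U]
    (X : μ.Ω → S) (Y : μ.Ω → T) (Z : μ.Ω → U) : ℝ :=
  μ.H (fun ω => (X ω, Z ω)) + μ.H (fun ω => (Y ω, Z ω))
    - μ.H (fun ω => (X ω, Y ω, Z ω)) - μ.H Z

/-- Independence of two random variables: the joint pmf factorizes. -/
def IndepRV (μ : FinProbSpace) {S T : Type} [DecidableEq S] [DecidableEq T]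
    (X : μ.Ω → S) (Y : μ.Ω → T) : Prop :=
  ∀ s t, μ.prob (fun ω => (X ω, Y ω)) (s, t) = μ.prob X s * μ.prob Y t

end FinProbSpace

open FinProbSpace

namespace FinProbSpace

attribute [local instance] FinProbSpace.fin

section Prob

variable (μ : FinProbSpace) {S T : Type} [DecidableEq S] [DecidableEq T]

theorem sum_p : ∑ ω : μ.Ω, μ.p ω = 1 := μ.sum_one

theorem prob_nonneg (X : μ.Ω → S) (s : S) : 0 ≤ μ.prob X s :=
  Finset.sum_nonneg fun ω _ => by
    split_ifs
    exacts [μ.nonneg ω, le_rfl]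

theorem p_le_prob (X : μ.Ω → S) (ω : μ.Ω) : μ.p ω ≤ μ.prob X (X ω) := by
  have h := Finset.single_le_sum (s := Finset.univ)
    (f := fun ω' => if X ω' = X ω then μ.p ω' else 0)
    (fun ω' _ => by
      split_ifs
      exacts [μ.nonneg ω', le_rfl])
    (Finset.mem_univ ω)
  simpa [prob] using h

theorem sum_prob_mul [Fintype S] (X : μ.Ω → S) (g : S → ℝ) :
    ∑ s, μ.prob X s * g s = ∑ ω, μ.p ω * g (X ω) := by
  simp only [prob, Finset.sum_mul]
  rw [Finset.sum_comm]
  refine Finset.sum_congr rfl fun ω _ => ?_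
  simp [ite_mul]

theorem sum_prob [Fintype S] (X : μ.Ω → S) : ∑ s, μ.prob X s = 1 := by
  simpa [sum_p] using μ.sum_prob_mul X fun _ => 1

theorem sum_prob_prod [Fintype S] (X : μ.Ω → S) (Y : μ.Ω → T) (t : T) :
    ∑ s, μ.prob (fun ω => (X ω, Y ω)) (s, t) = μ.prob Y t := by
  simp only [prob, Prod.mk.injEq]
  rw [Finset.sum_comm]
  refine Finset.sum_congr rfl fun ω _ => ?_
  simp [ite_and]

theorem prob_le_prob_of_determines {X : μ.Ω → S} {Y : μ.Ω → T}
    (h : ∀ ω ω', X ω = X ω' → Y ω = Y ω') (ω : μ.Ω) :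
    μ.prob X (X ω) ≤ μ.prob Y (Y ω) := by
  refine Finset.sum_le_sum fun ω' _ => ?_
  by_cases hX : X ω' = X ω
  · simp [hX, h _ _ hX]
  · rw [if_neg hX]
    split_ifs
    exacts [μ.nonneg ω', le_rfl]

end Prob

section Entropy

variable (μ : FinProbSpace) {S T U V : Type}
  [Fintype S] [DecidableEq S] [Fintype T] [DecidableEq T]
  [Fintype U] [DecidableEq U] [Fintype V] [DecidableEq V]

theorem H_eq_sum (X : μ.Ω → S) :
    μ.H X = ∑ ω, μ.p ω * -Real.log (μ.prob X (X ω)) := by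
  rw [← μ.sum_prob_mul X fun s => -Real.log (μ.prob X s)]
  simp [H, Real.negMulLog]

/-- A random variable has at least the entropy of every variable it determines. -/
theorem H_le_H_of_determines {X : μ.Ω → S} {Y : μ.Ω → T}
    (h : ∀ ω ω', X ω = X ω' → Y ω = Y ω') : μ.H Y ≤ μ.H X := by
  rw [H_eq_sum, H_eq_sum]
  refine Finset.sum_le_sum fun ω _ => ?_
  rcases (μ.nonneg ω).eq_or_lt with h0 | h0
  · simp [← h0]
  · have h1 := Real.log_le_log (h0.trans_le (μ.p_le_prob X ω))
      (μ.prob_le_prob_of_determines h ω)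
    exact mul_le_mul_of_nonneg_left (neg_le_neg h1) h0.le

theorem H_const : μ.H (fun _ => ()) = 0 := by
  have h : μ.prob (fun _ => ()) () = 1 := by simp [prob, sum_p]
  simp [H, h]

theorem H_prod_add_H_le (X : μ.Ω → S) (Y : μ.Ω → T) (Z : μ.Ω → U) :
    μ.H (fun ω => (X ω, Y ω, Z ω)) + μ.H Z
      ≤ μ.H (fun ω => (X ω, Z ω)) + μ.H (fun ω => (Y ω, Z ω)) := by
  set a := μ.prob fun ω => (X ω, Z ω)
  set b := μ.prob fun ω => (Y ω, Z ω)
  set c := μ.prob fun ω => (X ω, Y ω, Z ω)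
  set d := μ.prob Z
  let g : S × T × U → ℝ := fun v => a (v.1, v.2.2) * b v.2 / (c v * d v.2.2)
  have key : ∑ ω, μ.p ω * g (X ω, Y ω, Z ω) ≤ 1 := by
    rw [← μ.sum_prob_mul (fun ω => (X ω, Y ω, Z ω)) g]
    calc ∑ v, c v * g v
        ≤ ∑ v : S × T × U, a (v.1, v.2.2) * b v.2 / d v.2.2 := by
          refine Finset.sum_le_sum fun v _ => ?_
          have hv : 0 ≤ a (v.1, v.2.2) * b v.2 / d v.2.2 :=
            div_nonneg (mul_nonneg (μ.prob_nonneg _ _) (μ.prob_nonneg _ _))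
              (μ.prob_nonneg _ _)
          by_cases hc : c v = 0
          · simpa [hc] using hv
          · simp only [g]
            rw [mul_div_assoc', mul_div_mul_left _ _ hc]
      _ = ∑ u, d u * d u / d u := by
          rw [Fintype.sum_prod_type]
          simp only [Fintype.sum_prod_type_right]
          rw [Finset.sum_comm]
          refine Finset.sum_congr rfl fun u _ => ?_
          simp only [← Finset.sum_div, ← Finset.mul_sum, ← Finset.sum_mul]
          rw [μ.sum_prob_prod X Z u, μ.sum_prob_prod Y Z u]
      _ = 1 := by
          simp only [mul_self_div_self]
          exact μ.sum_prob Z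
  have hlog : ∀ ω, μ.p ω * -Real.log (c (X ω, Y ω, Z ω)) + μ.p ω * -Real.log (d (Z ω))
      ≤ μ.p ω * -Real.log (a (X ω, Z ω)) + μ.p ω * -Real.log (b (Y ω, Z ω))
        + (μ.p ω * g (X ω, Y ω, Z ω) - μ.p ω) := by
    intro ω
    rcases (μ.nonneg ω).eq_or_lt with h0 | h0
    · simp [← h0]
    · have ha : 0 < a (X ω, Z ω) := h0.trans_le (μ.p_le_prob (fun ω => (X ω, Z ω)) ω)
      have hb : 0 < b (Y ω, Z ω) := h0.trans_le (μ.p_le_prob (fun ω => (Y ω, Z ω)) ω)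
      have hc : 0 < c (X ω, Y ω, Z ω) :=
        h0.trans_le (μ.p_le_prob (fun ω => (X ω, Y ω, Z ω)) ω)
      have hd : 0 < d (Z ω) := h0.trans_le (μ.p_le_prob Z ω)
      have h1 : Real.log (g (X ω, Y ω, Z ω)) ≤ g (X ω, Y ω, Z ω) - 1 :=
        Real.log_le_sub_one_of_pos (by positivity)
      have h2 : Real.log (g (X ω, Y ω, Z ω)) = Real.log (a (X ω, Z ω))
          + Real.log (b (Y ω, Z ω))
          - (Real.log (c (X ω, Y ω, Z ω)) + Real.log (d (Z ω))) := by
        simp only [g]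
        rw [Real.log_div (by positivity) (by positivity), Real.log_mul ha.ne' hb.ne',
          Real.log_mul hc.ne' hd.ne']
      rw [h2] at h1
      nlinarith [mul_le_mul_of_nonneg_left h1 h0.le]
  have hsum := Finset.sum_le_sum fun ω (_ : ω ∈ Finset.univ) => hlog ω
  simp only [Finset.sum_add_distrib, Finset.sum_sub_distrib, sum_p] at hsum
  simp only [H_eq_sum]
  linarith

/-- Submodularity of entropy: `D` is a common function of `A` and `B`, and `C` is a function of
the pair `(A, B)`. -/
theorem H_add_H_le_of_determines {A : μ.Ω → S} {B : μ.Ω → T} {C : μ.Ω → U} {D : μ.Ω → V}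
    (hA : ∀ ω ω', A ω = A ω' → D ω = D ω') (hB : ∀ ω ω', B ω = B ω' → D ω = D ω')
    (hC : ∀ ω ω', A ω = A ω' → B ω = B ω' → C ω = C ω') :
    μ.H C + μ.H D ≤ μ.H A + μ.H B := by
  have h := μ.H_prod_add_H_le A B D
  have h1 : μ.H C ≤ μ.H fun ω => (A ω, B ω, D ω) :=
    μ.H_le_H_of_determines fun ω ω' e => by
      simp only [Prod.mk.injEq] at e
      exact hC ω ω' e.1 e.2.1
  have h2 : μ.H (fun ω => (A ω, D ω)) ≤ μ.H A :=
    μ.H_le_H_of_determines fun ω ω' e => by rw [e, hA ω ω' e]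
  have h3 : μ.H (fun ω => (B ω, D ω)) ≤ μ.H B :=
    μ.H_le_H_of_determines fun ω ω' e => by rw [e, hB ω ω' e]
  linarith

theorem H_prod_le (X : μ.Ω → S) (Y : μ.Ω → T) :
    μ.H (fun ω => (X ω, Y ω)) ≤ μ.H X + μ.H Y := by
  have h := μ.H_add_H_le_of_determines (A := X) (B := Y) (C := fun ω => (X ω, Y ω))
    (D := fun _ => ()) (fun _ _ _ => rfl) (fun _ _ _ => rfl) fun ω ω' h1 h2 => by rw [h1, h2]
  rwa [H_const, add_zero] at h

/-- Independence of `Y` passes to every variable `Z` determined by `Y`. -/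
theorem H_prod_eq_of_MI_eq_zero {X : μ.Ω → S} {Y : μ.Ω → T} {Z : μ.Ω → U}
    (hXY : μ.MI X Y = 0) (h : ∀ ω ω', Y ω = Y ω' → Z ω = Z ω') :
    μ.H (fun ω => (X ω, Z ω)) = μ.H X + μ.H Z := by
  have h1 := μ.H_add_H_le_of_determines (A := fun ω => (X ω, Z ω)) (B := Y)
    (C := fun ω => (X ω, Y ω)) (D := Z) (by simp) h (by simp +contextual)
  have h2 := μ.H_prod_le X Z
  unfold MI at hXY
  linarith

/-- If `H(X | Y) = 0` then adjoining `X` to a variable `Z` that determines `Y` does not increase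
its entropy. -/
theorem H_prod_le_of_Hc_eq_zero {X : μ.Ω → S} {Y : μ.Ω → T} {Z : μ.Ω → U}
    (hXY : μ.Hc X Y = 0) (h : ∀ ω ω', Z ω = Z ω' → Y ω = Y ω') :
    μ.H (fun ω => (X ω, Z ω)) ≤ μ.H Z := by
  have h1 := μ.H_add_H_le_of_determines (A := fun ω => (X ω, Y ω)) (B := Z)
    (C := fun ω => (X ω, Z ω)) (D := Y) (by simp) h (by simp +contextual)
  unfold Hc at hXY
  linarith

/-- If each member of a finite family satisfies `H(X i | Y) = 0`, then so does the joint
variable. -/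
theorem H_family_prod_le {ι : Type} [DecidableEq ι] {X : ι → μ.Ω → S} {Y : μ.Ω → T}
    (s : Finset ι) (hX : ∀ i ∈ s, μ.Hc (X i) Y = 0) :
    μ.H (fun ω => ((fun i : s => X i ω), Y ω)) ≤ μ.H Y := by
  induction s using Finset.induction_on with
  | empty =>
    refine μ.H_le_H_of_determines fun ω ω' e => ?_
    rw [Prod.mk.injEq]
    exact ⟨funext fun i => absurd i.2 (Finset.notMem_empty _), e⟩
  | insert i s _ ih =>
    have h1 := ih fun j hj => hX j (Finset.mem_insert_of_mem hj)
    have h2 := μ.H_prod_le_of_Hc_eq_zero (Z := fun ω => ((fun i : s => X i ω), Y ω))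
      (hX i (Finset.mem_insert_self i s)) (by simp)
    refine le_trans (μ.H_le_H_of_determines fun ω ω' e => ?_) (h2.trans h1)
    simp only [Prod.mk.injEq, funext_iff, Subtype.forall, Finset.mem_insert] at e ⊢
    refine ⟨?_, e.2.2⟩
    rintro j (rfl | hj)
    exacts [e.1, e.2.1 j hj]

end Entropy

section Groupcast

variable (μ : FinProbSpace) {S T U V : Type}
  [Fintype S] [DecidableEq S] [Fintype T] [DecidableEq T]
  [Fintype U] [DecidableEq U] [Fintype V] [DecidableEq V]

/-- A broadcast no larger than the message it delivers is determined by the message and the key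
of any qualified receiver. -/
theorem Hc_broadcast_eq_zero {W : μ.Ω → S} {Z : μ.Ω → T} {X : μ.Ω → U}
    (hInd : μ.H (fun ω => (W ω, Z ω)) = μ.H W + μ.H Z)
    (hCorr : μ.Hc W (fun ω => (X ω, Z ω)) = 0) (hB : μ.H X ≤ μ.H W) :
    μ.Hc X (fun ω => (W ω, Z ω)) = 0 := by
  have h1 := μ.H_prod_le X Z
  have h2 : μ.H (fun ω => (X ω, W ω, Z ω)) ≤ μ.H fun ω => (W ω, X ω, Z ω) :=
    μ.H_le_H_of_determines (by simp +contextual)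
  have h3 : μ.H (fun ω => (W ω, Z ω)) ≤ μ.H fun ω => (X ω, W ω, Z ω) :=
    μ.H_le_H_of_determines (by simp)
  unfold Hc at hCorr ⊢
  linarith

/-- If the key `Z'` allows decoding of `W` from `X` and the pair of keys `(Z, Z')` is independent
of `W`, then `H(X | Z)` is at least `H(W)`. -/
theorem H_add_H_le_H_broadcast {W : μ.Ω → S} {Z : μ.Ω → T} {Z' : μ.Ω → V} {X : μ.Ω → U}
    (hInd : μ.H (fun ω => (W ω, Z ω, Z' ω)) = μ.H W + μ.H fun ω => (Z ω, Z' ω))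
    (hCorr : μ.Hc W (fun ω => (X ω, Z' ω)) = 0) :
    μ.H W + μ.H Z ≤ μ.H fun ω => (X ω, Z ω) := by
  have h1 := μ.H_add_H_le_of_determines (A := fun ω => (X ω, Z ω)) (B := fun ω => (Z ω, Z' ω))
    (C := fun ω => (X ω, Z ω, Z' ω)) (D := Z) (by simp) (by simp +contextual)
    (by simp +contextual)
  have h2 := μ.H_prod_le_of_Hc_eq_zero (Z := fun ω => (X ω, Z ω, Z' ω)) hCorr
    (by simp +contextual)
  have h3 : μ.H (fun ω => (W ω, Z ω, Z' ω)) ≤ μ.H fun ω => (W ω, X ω, Z ω, Z' ω) :=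
    μ.H_le_H_of_determines (by simp +contextual)
  linarith

end Groupcast

end FinProbSpace

/-- **Converse of Theorem 2**: at minimum broadcast bandwidth (β = 1), key
storage satisfies α ≥ N. Receivers are indexed by `Fin (N+1)`; for
`i : Fin N`, the qualified set `Q_i` is `{1,…,N+1} \ {i}` (i.e. everything
except `i.castSucc`), with broadcast signal `X i`. Then
`H(Z_{N+1}) ≥ N · H(W)`. -/
theorem min_bandwidth_key_storage_converse
    (μ : FinProbSpace) {N : ℕ} (hN : 1 ≤ N) {SW SZ SX : Type}
    [Fintype SW] [DecidableEq SW] [Fintype SZ] [DecidableEq SZ]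
    [Fintype SX] [DecidableEq SX]
    (W : μ.Ω → SW) (Z : Fin (N + 1) → μ.Ω → SZ) (X : Fin N → μ.Ω → SX)
    (hInd : μ.MI W (fun ω => fun k : Fin (N + 1) => Z k ω) = 0)
    (hCorr : ∀ (i : Fin N) (q : Fin (N + 1)), q ≠ i.castSucc →
      μ.Hc W (fun ω => (X i ω, Z q ω)) = 0)
    (hSec : ∀ i : Fin N, μ.MI W (fun ω => (X i ω, Z i.castSucc ω)) = 0)
    (hB : ∀ i : Fin N, μ.H (X i) ≤ μ.H W) :
    μ.H (Z (Fin.last N)) ≥ N * μ.H W := by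
  have hKeys : ∀ q, μ.H (fun ω => (W ω, Z q ω)) = μ.H W + μ.H (Z q) := fun q =>
    μ.H_prod_eq_of_MI_eq_zero hInd fun _ _ e => congrFun e q
  have hDet : ∀ i q, q ≠ Fin.castSucc i → μ.Hc (X i) (fun ω => (W ω, Z q ω)) = 0 := fun i q hq =>
    μ.Hc_broadcast_eq_zero (hKeys q) (hCorr i q hq) (hB i)
  have hLast : ∀ i : Fin N, Fin.last N ≠ i.castSucc := fun i => (Fin.castSucc_lt_last i).ne'
  have hJoint : ∀ s : Finset (Fin N),
      μ.H W + s.card * μ.H W ≤ μ.H (fun ω => (W ω, fun i : s => X i ω)) := by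
    intro s
    induction s using Finset.induction_on with
    | empty =>
      simpa using μ.H_le_H_of_determines (X := fun ω => (W ω, fun i : (∅ : Finset (Fin N)) => X i ω))
        (Y := W) (by simp +contextual)
    | insert i s hi ih =>
      have hSub := μ.H_add_H_le_of_determines
        (A := fun ω => (W ω, fun j : (insert i s : Finset (Fin N)) => X j ω))
        (B := fun ω => ((fun j : s => X j ω), W ω, Z i.castSucc ω))
        (C := fun ω => (W ω, X i ω, Z i.castSucc ω))
        (D := fun ω => (W ω, fun j : s => X j ω))
        (by simp +contextual [funext_iff]) (by simp +contextual) (by simp +contextual [funext_iff])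
      have hPrev := μ.H_family_prod_le s fun j hj => hDet j i.castSucc fun h =>
        hi (Fin.castSucc_injective N h ▸ hj)
      have hNew := μ.H_add_H_le_H_broadcast (Z := Z i.castSucc)
        (μ.H_prod_eq_of_MI_eq_zero hInd fun ω ω' e => by
          rw [congrFun e i.castSucc, congrFun e (Fin.last N)])
        (hCorr i _ (hLast i))
      have hSec' := hSec i
      have hKey := hKeys i.castSucc
      unfold MI at hSec'
      rw [Finset.card_insert_of_notMem hi]
      push_cast
      linarith
  have hAll := μ.H_family_prod_le Finset.univ fun i _ => hDet i (Fin.last N) (hLast i)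
  have hMono : μ.H (fun ω => (W ω, fun i : (Finset.univ : Finset (Fin N)) => X i ω))
      ≤ μ.H (fun ω => ((fun i : (Finset.univ : Finset (Fin N)) => X i ω),
        W ω, Z (Fin.last N) ω)) :=
    μ.H_le_H_of_determines (by simp +contextual)
  have hLower := hJoint Finset.univ
  have hKey := hKeys (Fin.last N)
  rw [Finset.card_univ, Fintype.card_fin] at hLower
  linarith
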